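/- Under the robust adaptation setting, assume additionally that there exists M > 0 such that X_kᵀ X_k ≤ M and g_{k+1}ᵀ g_{k+1} ≤ M for all k ≥ 1. Then the series Σ_k (‖g̃_{k+1} − w*_k‖² + ‖x̃_{k+1} − v*_k‖²) converges, and consequently ‖g̃_{k+1} − w*_k‖ → 0 and ‖x̃_{k+1} − v*_k‖ → 0 as k → ∞. -/

import Mathlib

open Matrix

lemma dot_self_nonneg' {a : ℕ} (e : Fin a → ℝ) : 0 ≤ e ⬝ᵥ e :=
  Finset.sum_nonneg fun i _ => mul_self_nonneg (e i)

lemma proj_ineq {a : ℕ} (S : Set (Fin a → ℝ)) (hS : Convex ℝ S) (y p q : Fin a → ℝ)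
    (hp : p ∈ S) (hq : q ∈ S)
    (hmin : ∀ r ∈ S, (y - p) ⬝ᵥ (y - p) ≤ (y - r) ⬝ᵥ (y - r)) :
    (y - p) ⬝ᵥ (q - p) ≤ 0 := by
  have key : ∀ t : ℝ, 0 < t → t ≤ 1 →
      2 * ((y - p) ⬝ᵥ (q - p)) ≤ t * ((q - p) ⬝ᵥ (q - p)) := by
    intro t ht ht1
    have hr : p + t • (q - p) ∈ S := hS.add_smul_sub_mem hp hq ⟨ht.le, ht1⟩
    have h1 := hmin _ hr
    have h2 : y - (p + t • (q - p)) = (y - p) - t • (q - p) := by abel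
    rw [h2] at h1
    generalize y - p = e at *
    generalize q - p = d at *
    simp only [sub_dotProduct, dotProduct_sub, smul_dotProduct, dotProduct_smul,
      smul_eq_mul] at h1
    rw [dotProduct_comm d e] at h1
    have : 0 ≤ t * (t * (d ⬝ᵥ d) - 2 * (e ⬝ᵥ d)) := by linarith
    have := nonneg_of_mul_nonneg_right this ht
    linarith
  have hd := dot_self_nonneg' (q - p)
  generalize (q - p) ⬝ᵥ (q - p) = D at *
  generalize (y - p) ⬝ᵥ (q - p) = E at *
  by_contra hE
  push Not at hE
  have h1 := key 1 one_pos le_rfl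
  have hD : 0 < D := by linarith
  have h2 := key (E / D) (by positivity) (by rw [div_le_one hD]; linarith)
  rw [div_mul_cancel₀ _ hD.ne'] at h2
  linarith

lemma trace_update {a b : ℕ} (A : Matrix (Fin a) (Fin b) ℝ) (e : Fin a → ℝ) (X : Fin b → ℝ)
    (l : ℝ) :
    ((A - l • vecMulVec e X)ᵀ * (A - l • vecMulVec e X)).trace
      = (Aᵀ * A).trace - 2 * l * (e ⬝ᵥ A.mulVec X) + l ^ 2 * (e ⬝ᵥ e) * (X ⬝ᵥ X) := by
  have h1 : ((vecMulVec e X)ᵀ * A).trace = e ⬝ᵥ A.mulVec X := by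
    rw [transpose_vecMulVec, vecMulVec_mul, trace_vecMulVec, dotProduct_comm,
      ← dotProduct_mulVec]
  have h2 : (Aᵀ * vecMulVec e X).trace = e ⬝ᵥ A.mulVec X := by
    rw [← h1, ← trace_transpose]
    simp [transpose_mul]
  have h3 : ((vecMulVec e X)ᵀ * vecMulVec e X).trace = (e ⬝ᵥ e) * (X ⬝ᵥ X) := by
    rw [transpose_vecMulVec, vecMulVec_mul_vecMulVec]
    simp [trace_vecMulVec]
  simp only [transpose_sub, transpose_smul, Matrix.sub_mul, Matrix.mul_sub, trace_sub, Matrix.smul_mul, Matrix.mul_smul,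
    trace_smul, h1, h2, h3, smul_eq_mul]
  ring

lemma trace_nonneg' {a b : ℕ} (A : Matrix (Fin a) (Fin b) ℝ) : 0 ≤ (Aᵀ * A).trace := by
  simp only [trace, diag, mul_apply, transpose_apply]
  exact Finset.sum_nonneg fun i _ => Finset.sum_nonneg fun j _ => mul_self_nonneg _

lemma dot_self_pos' {a : ℕ} (e : Fin a → ℝ) (he : e ≠ 0) : 0 < e ⬝ᵥ e :=
  lt_of_le_of_ne (dot_self_nonneg' e) fun h => he (dotProduct_self_eq_zero.1 h.symm)

/-- One-block decrease. -/
lemma block_decrease {a b : ℕ} (S : Set (Fin a → ℝ)) (hS : Convex ℝ S)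
    (A B B' : Matrix (Fin a) (Fin b) ℝ) (X : Fin b → ℝ) (y z p q : Fin a → ℝ) (l c α : ℝ)
    (hα : 0 < α) (hp : p ∈ S) (hq : q ∈ S)
    (hmin : ∀ r ∈ S, (y - p) ⬝ᵥ (y - p) ≤ (y - r) ⬝ᵥ (y - r))
    (hz : z = A.mulVec X + q) (hy : y = z - B.mulVec X)
    (hB : B' = B + l • vecMulVec (y - p) X)
    (hc : 0 ≤ c) (hcl : c ≤ l) (hl : l * (X ⬝ᵥ X) ≤ 2 - α) :
    ((A - B')ᵀ * (A - B')).trace + α * c * ((y - p) ⬝ᵥ (y - p))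
      ≤ ((A - B)ᵀ * (A - B)).trace := by
  have h1 := proj_ineq S hS y p q hp hq hmin
  have hAB : A - B' = (A - B) - l • vecMulVec (y - p) X := by rw [hB]; abel
  have hAX : (A - B).mulVec X = (y - p) - (q - p) := by
    rw [sub_mulVec, hy, hz]; abel
  rw [hAB, trace_update, hAX, dotProduct_sub]
  have hE := dot_self_nonneg' (y - p)
  generalize (y - p) ⬝ᵥ (y - p) = E at *
  generalize (y - p) ⬝ᵥ (q - p) = F at *
  generalize X ⬝ᵥ X = Q at *
  have hl0 : 0 ≤ l := hc.trans hcl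
  have a1 : 0 ≤ l * E * (2 - α - l * Q) :=
    mul_nonneg (mul_nonneg hl0 hE) (by linarith)
  have a2 : 0 ≤ α * E * (l - c) := mul_nonneg (mul_nonneg hα.le hE) (by linarith)
  have a3 : 0 ≤ l * (-F) := mul_nonneg hl0 (by linarith)
  nlinarith

/-- Robust adaptation: under uniform boundedness of `X_kᵀX_k` and `g_{k+1}ᵀg_{k+1}`,
the series `Σ_k (‖g̃_{k+1} − w*_k‖² + ‖x̃_{k+1} − v*_k‖²)` converges, and
`‖g̃_{k+1} − w*_k‖ → 0` and `‖x̃_{k+1} − v*_k‖ → 0` as `k → ∞`. -/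
theorem robust_errors_converge
    (h n m : ℕ) (hh : 1 ≤ h) (hn : 1 ≤ n) (hm : 1 ≤ m)
    (α : ℝ) (hα : 0 < α) (hα2 : α < 2)
    (Ψ : Matrix (Fin h) (Fin (h + m)) ℝ) (C : Matrix (Fin n) (Fin h) ℝ)
    (W : Set (Fin h → ℝ)) (Vs : Set (Fin n → ℝ))
    (hWne : W.Nonempty) (hWcl : IsClosed W) (hWcv : Convex ℝ W)
    (hWbd : Bornology.IsBounded W)
    (hVne : Vs.Nonempty) (hVcl : IsClosed Vs) (hVcv : Convex ℝ Vs)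
    (hVbd : Bornology.IsBounded Vs)
    (X : ℕ → Fin (h + m) → ℝ) (g : ℕ → Fin h → ℝ) (x : ℕ → Fin n → ℝ)
    (w : ℕ → Fin h → ℝ) (v : ℕ → Fin n → ℝ)
    (hw : ∀ k ≥ 1, w k ∈ W) (hv : ∀ k ≥ 1, v k ∈ Vs)
    (hgdyn : ∀ k ≥ 1, g (k + 1) = Ψ.mulVec (X k) + w k)
    (hxdyn : ∀ k ≥ 1, x (k + 1) = C.mulVec (g (k + 1)) + v k)
    (hXne : ∀ k ≥ 1, X k ≠ 0) (hgne : ∀ k ≥ 1, g (k + 1) ≠ 0)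
    (Ψhat : ℕ → Matrix (Fin h) (Fin (h + m)) ℝ) (Chat : ℕ → Matrix (Fin n) (Fin h) ℝ)
    (gt : ℕ → Fin h → ℝ) (xt : ℕ → Fin n → ℝ) (lam : ℕ → ℝ)
    (wstar : ℕ → Fin h → ℝ) (vstar : ℕ → Fin n → ℝ)
    (hgt : ∀ k ≥ 1, gt (k + 1) = g (k + 1) - (Ψhat k).mulVec (X k))
    (hxt : ∀ k ≥ 1, xt (k + 1) = x (k + 1) - (Chat k).mulVec (g (k + 1)))
    (hwstar : ∀ k ≥ 1, wstar k ∈ W) (hvstar : ∀ k ≥ 1, vstar k ∈ Vs)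
    (hstarmin : ∀ k ≥ 1, ∀ w' ∈ W, ∀ v' ∈ Vs,
      (gt (k + 1) - wstar k) ⬝ᵥ (gt (k + 1) - wstar k)
        + (xt (k + 1) - vstar k) ⬝ᵥ (xt (k + 1) - vstar k) ≤
      (gt (k + 1) - w') ⬝ᵥ (gt (k + 1) - w')
        + (xt (k + 1) - v') ⬝ᵥ (xt (k + 1) - v'))
    (hlam : ∀ k ≥ 1, lam k =
      min ((2 - α) / (X k ⬝ᵥ X k)) ((2 - α) / (g (k + 1) ⬝ᵥ g (k + 1))))
    (hΨup : ∀ k ≥ 1, Ψhat (k + 1)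
        = Ψhat k + lam k • vecMulVec (gt (k + 1) - wstar k) (X k))
    (hCup : ∀ k ≥ 1, Chat (k + 1)
        = Chat k + lam k • vecMulVec (xt (k + 1) - vstar k) (g (k + 1)))
    (V : ℕ → ℝ)
    (hV : ∀ k ≥ 1, V k = ((Ψ - Ψhat k)ᵀ * (Ψ - Ψhat k)).trace
        + ((C - Chat k)ᵀ * (C - Chat k)).trace)
    (Mb : ℝ) (hMb : 0 < Mb)
    (hXb : ∀ k ≥ 1, X k ⬝ᵥ X k ≤ Mb) (hgb : ∀ k ≥ 1, g (k + 1) ⬝ᵥ g (k + 1) ≤ Mb) :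
    Summable (fun k => (gt (k + 1) - wstar k) ⬝ᵥ (gt (k + 1) - wstar k)
        + (xt (k + 1) - vstar k) ⬝ᵥ (xt (k + 1) - vstar k)) ∧
    Filter.Tendsto
      (fun k => Real.sqrt ((gt (k + 1) - wstar k) ⬝ᵥ (gt (k + 1) - wstar k)))
      Filter.atTop (nhds 0) ∧
    Filter.Tendsto
      (fun k => Real.sqrt ((xt (k + 1) - vstar k) ⬝ᵥ (xt (k + 1) - vstar k)))
      Filter.atTop (nhds 0) := by
  set E : ℕ → ℝ := fun k => (gt (k + 1) - wstar k) ⬝ᵥ (gt (k + 1) - wstar k) with hE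
  set F : ℕ → ℝ := fun k => (xt (k + 1) - vstar k) ⬝ᵥ (xt (k + 1) - vstar k) with hF
  have hE0 : ∀ k, 0 ≤ E k := fun k => dot_self_nonneg' _
  have hF0 : ∀ k, 0 ≤ F k := fun k => dot_self_nonneg' _
  set c : ℝ := (2 - α) / Mb with hcdef
  have h2α : 0 < 2 - α := by linarith
  have hc : 0 < c := div_pos h2α hMb
  have hdec : ∀ k ≥ 1, V (k + 1) + α * c * (E k + F k) ≤ V k := by
    intro k hk
    have hXp := dot_self_pos' _ (hXne k hk)
    have hgp := dot_self_pos' _ (hgne k hk)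
    have hcl : c ≤ lam k := by
      rw [hlam k hk]
      exact le_min (div_le_div_of_nonneg_left h2α.le hXp (hXb k hk))
        (div_le_div_of_nonneg_left h2α.le hgp (hgb k hk))
    have hl1 : lam k * (X k ⬝ᵥ X k) ≤ 2 - α := by
      rw [← le_div_iff₀ hXp, hlam k hk]; exact min_le_left _ _
    have hl2 : lam k * (g (k + 1) ⬝ᵥ g (k + 1)) ≤ 2 - α := by
      rw [← le_div_iff₀ hgp, hlam k hk]; exact min_le_right _ _
    have b1 := block_decrease W hWcv Ψ (Ψhat k) (Ψhat (k + 1)) (X k) (gt (k + 1)) (g (k + 1))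
      (wstar k) (w k) (lam k) c α hα (hwstar k hk) (hw k hk)
      (fun r hr => by linarith [hstarmin k hk r hr (vstar k) (hvstar k hk)])
      (hgdyn k hk) (hgt k hk) (hΨup k hk) hc.le hcl hl1
    have b2 := block_decrease Vs hVcv C (Chat k) (Chat (k + 1)) (g (k + 1)) (xt (k + 1))
      (x (k + 1)) (vstar k) (v k) (lam k) c α hα (hvstar k hk) (hv k hk)
      (fun r hr => by linarith [hstarmin k hk (wstar k) (hwstar k hk) r hr])
      (hxdyn k hk) (hxt k hk) (hCup k hk) hc.le hcl hl2
    rw [hV k hk, hV (k + 1) (by omega)]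
    simp only [hE, hF]
    linarith
  have hV0 : ∀ k ≥ 1, 0 ≤ V k := fun k hk => by
    rw [hV k hk]; exact add_nonneg (trace_nonneg' _) (trace_nonneg' _)
  have hαc : 0 < α * c := mul_pos hα hc
  have hsum : ∀ N : ℕ, V (N + 1) + α * c * ∑ i ∈ Finset.range N, (E (i + 1) + F (i + 1)) ≤ V 1 := by
    intro N
    induction N with
    | zero => simp
    | succ N ih =>
      rw [Finset.sum_range_succ]
      have := hdec (N + 1) (by omega)
      linarith
  have hS : Summable (fun k => E k + F k) := by
    rw [← summable_nat_add_iff 1]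
    refine summable_of_sum_range_le (c := V 1 / (α * c))
      (fun k => add_nonneg (hE0 _) (hF0 _)) (fun N => ?_)
    rw [le_div_iff₀ hαc]
    linarith [hsum N, hV0 (N + 1) (by omega)]
  have hT := hS.tendsto_atTop_zero
  have hTE : Filter.Tendsto E Filter.atTop (nhds 0) :=
    squeeze_zero hE0 (fun k => le_add_of_nonneg_right (hF0 k)) hT
  have hTF : Filter.Tendsto F Filter.atTop (nhds 0) :=
    squeeze_zero hF0 (fun k => le_add_of_nonneg_left (hE0 k)) hT
  refine ⟨hS, ?_, ?_⟩
  · have hq := hTE.sqrt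
    rw [Real.sqrt_zero] at hq
    exact hq
  · have hq := hTF.sqrt
    rw [Real.sqrt_zero] at hq
    exact hq
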